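/- Let t be a rational number with t ≥ 2. Every minimally t-tough, claw-free graph has a vertex of degree at most ⌈(10t−5)/3⌉. -/

import Mathlib

open SimpleGraph

variable {V : Type*}

/-- `numComponents G S` is the number of connected components of `G − S`,
the graph obtained from `G` by deleting the vertices of `S`. -/
noncomputable def numComponents (G : SimpleGraph V) (S : Set V) : ℕ :=
  Nat.card ((G.induce Sᶜ).ConnectedComponent)

/-- `HasToughness G t` says that the toughness of `G` is exactly `t`, i.e.
`t = min { |S| / w(G−S) : S ⊆ V(G), w(G−S) ≥ 2 }`.  (For a complete graph no
such `S` exists and this predicate never holds, matching `τ(G) = ∞`.) -/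
def HasToughness [Fintype V] (G : SimpleGraph V) (t : ℚ) : Prop :=
  (∀ S : Finset V, 2 ≤ numComponents G ↑S →
      t ≤ (S.card : ℚ) / (numComponents G ↑S : ℚ)) ∧
  ∃ S : Finset V, 2 ≤ numComponents G ↑S ∧
      t = (S.card : ℚ) / (numComponents G ↑S : ℚ)

/-- `G` is minimally `t`-tough: `τ(G) = t` and `τ(G − e) < t` for every edge
`e` of `G` (i.e. some vertex set witnesses a ratio `< t` in `G − e`). -/
def MinimallyTough [Fintype V] (G : SimpleGraph V) (t : ℚ) : Prop :=
  HasToughness G t ∧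
  ∀ u v : V, G.Adj u v →
    ∃ S : Finset V, 2 ≤ numComponents (G.deleteEdges {s(u, v)}) ↑S ∧
      (S.card : ℚ) / (numComponents (G.deleteEdges {s(u, v)}) ↑S : ℚ) < t

/-- `G` is claw-free: it has no induced subgraph isomorphic to `K_{1,3}`. -/
def ClawFree (G : SimpleGraph V) : Prop :=
  ¬ ∃ v a b c : V, a ≠ b ∧ a ≠ c ∧ b ≠ c ∧
      G.Adj v a ∧ G.Adj v b ∧ G.Adj v c ∧
      ¬ G.Adj a b ∧ ¬ G.Adj a c ∧ ¬ G.Adj b c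

/-- The vertex connectivity `κ(G)` of a noncomplete graph: the least cardinality
of a vertex set whose deletion disconnects `G`. -/
noncomputable def vconn [Fintype V] (G : SimpleGraph V) : ℕ :=
  sInf {k | ∃ S : Finset V, S.card = k ∧ 2 ≤ numComponents G ↑S}

/-- The vertex set of the connected component of `G − S` containing `u`
(empty if `u ∈ S`). -/
def compOf (G : SimpleGraph V) (S : Set V) (u : V) : Set V :=
  {w | ∃ (hu : u ∈ Sᶜ) (hw : w ∈ Sᶜ), (G.induce Sᶜ).Reachable ⟨u, hu⟩ ⟨w, hw⟩}

/-- `Dset G S u` is the union of the components of `G − S` other than the one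
containing `u`. -/
def Dset (G : SimpleGraph V) (S : Set V) (u : V) : Set V :=
  Sᶜ \ compOf G S u

/-- `nbrsIn G X Y = N_X(Y)`: the set of vertices in `X − Y` adjacent (in `G`)
to some vertex of `Y`. -/
def nbrsIn (G : SimpleGraph V) (X Y : Set V) : Set V :=
  {x | x ∈ X \ Y ∧ ∃ y ∈ Y, G.Adj x y}

/-- The edge `uv` is a bridge of the graph `G − S`: both endpoints survive the
deletion of `S`, they are adjacent, and deleting the edge `uv` increases the
number of connected components of `G − S`. -/
def IsBridgeIn (G : SimpleGraph V) (S : Set V) (u v : V) : Prop :=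
  u ∉ S ∧ v ∉ S ∧ G.Adj u v ∧
    numComponents G S < numComponents (G.deleteEdges {s(u, v)}) S

/-- `GoodCut G t u v S`: `S` is a vertex set with `w(G−S) ≤ |S|/t`,
`w((G−e)−S) > |S|/t` and such that `e = uv` is a bridge in `G − S`. -/
def GoodCut [Fintype V] (G : SimpleGraph V) (t : ℚ) (u v : V) (S : Finset V) : Prop :=
  (numComponents G ↑S : ℚ) ≤ (S.card : ℚ) / t ∧
  (S.card : ℚ) / t < (numComponents (G.deleteEdges {s(u, v)}) ↑S : ℚ) ∧
  IsBridgeIn G ↑S u v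

/-- `S` is a minimum-cardinality vertex set as guaranteed by Lemma 2.2,
i.e. `S = S(e)` for the edge `e = uv`. -/
def IsMinGoodCut [Fintype V] (G : SimpleGraph V) (t : ℚ) (u v : V) (S : Finset V) : Prop :=
  GoodCut G t u v S ∧ ∀ S' : Finset V, GoodCut G t u v S' → S.card ≤ S'.card

/-- `x` is contained in some `2t`-vertex-cut of `G`. -/
def InTwoTCut [Fintype V] (G : SimpleGraph V) (t : ℚ) (x : V) : Prop :=
  ∃ T : Finset V, (T.card : ℚ) = 2 * t ∧ 2 ≤ numComponents G ↑T ∧ x ∈ T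

/-- A fragment of `G`: the vertex set of a connected component of `G − T` for
some minimum vertex cut `T` of `G`. -/
def IsGraphFragment [Fintype V] (G : SimpleGraph V) (A : Set V) : Prop :=
  ∃ (T : Finset V) (a : V), T.card = vconn G ∧ 2 ≤ numComponents G ↑T ∧
    a ∉ T ∧ A = compOf G ↑T a

/-- An atom of `G`: a fragment of minimum cardinality. -/
def IsGraphAtom [Fintype V] (G : SimpleGraph V) (A : Set V) : Prop :=
  IsGraphFragment G A ∧ ∀ B : Set V, IsGraphFragment G B → A.ncard ≤ B.ncard

section Helpers

open Finset

attribute [local instance] Classical.propDecidable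

/-- `(F, W)` is a vertex cut: `F` is nonempty, all edges leaving `F` end in `W`, and
some vertex lies outside `F ∪ W`. -/
def IsCut (G : SimpleGraph V) (F W : Finset V) : Prop :=
  F.Nonempty ∧ Disjoint F W ∧ (∀ x ∈ F, ∀ y, G.Adj x y → y ∈ F ∨ y ∈ W) ∧
    ∃ z, z ∉ F ∧ z ∉ W

/-- A partition of the complement of `S` into nonempty classes closed under adjacency. -/
structure Parts (H : SimpleGraph V) (S : Finset V) (C : Finset (Finset V)) : Prop where
  ne : ∀ D ∈ C, D.Nonempty
  dis : ∀ D ∈ C, ∀ x ∈ D, x ∉ S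
  cov : ∀ x, x ∉ S → ∃ D ∈ C, x ∈ D
  uniq : ∀ D ∈ C, ∀ E ∈ C, ∀ x ∈ D, x ∈ E → D = E
  closed : ∀ D ∈ C, ∀ x ∈ D, ∀ y, H.Adj x y → y ∉ S → y ∈ D

theorem parts_exist [Fintype V] (H : SimpleGraph V) (S : Finset V) :
    ∃ C : Finset (Finset V), C.card = numComponents H ↑S ∧ Parts H S C := by
  let f : (H.induce ((S : Set V)ᶜ)).ConnectedComponent → Finset V := fun c =>
    univ.filter (fun x => ∃ h : x ∈ ((S : Set V)ᶜ),
      (H.induce ((S : Set V)ᶜ)).connectedComponentMk ⟨x, h⟩ = c)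
  have hf : Function.Injective f := by
    intro c c' h
    induction c using SimpleGraph.ConnectedComponent.ind with
    | h v =>
      have : (v : V) ∈ f ((H.induce ((S : Set V)ᶜ)).connectedComponentMk v) := by
        simp only [f, mem_filter, mem_univ, true_and]
        exact ⟨v.2, trivial⟩
      rw [h] at this
      simp only [f, mem_filter, mem_univ, true_and] at this
      obtain ⟨_, h2⟩ := this
      exact h2
  refine ⟨univ.image f, ?_, ?_, ?_, ?_, ?_, ?_⟩
  · rw [card_image_of_injective _ hf, numComponents, Nat.card_eq_fintype_card]
    rfl
  · intro D hD
    obtain ⟨c, -, rfl⟩ := mem_image.1 hD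
    induction c using SimpleGraph.ConnectedComponent.ind with
    | h v =>
      refine ⟨v, ?_⟩
      simp only [f, mem_filter, mem_univ, true_and]
      exact ⟨v.2, trivial⟩
  · intro D hD x hx
    obtain ⟨c, -, rfl⟩ := mem_image.1 hD
    simp only [f, mem_filter, mem_univ, true_and] at hx
    obtain ⟨h, -⟩ := hx
    simpa using h
  · intro x hx
    have hx' : x ∈ ((S : Set V)ᶜ) := by simpa using hx
    refine ⟨f ((H.induce ((S : Set V)ᶜ)).connectedComponentMk ⟨x, hx'⟩),
      mem_image_of_mem _ (mem_univ _), ?_⟩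
    simp only [f, mem_filter, mem_univ, true_and]
    exact ⟨hx', trivial⟩
  · intro D hD E hE x hx hx'
    obtain ⟨c, -, rfl⟩ := mem_image.1 hD
    obtain ⟨c', -, rfl⟩ := mem_image.1 hE
    simp only [f, mem_filter, mem_univ, true_and] at hx hx'
    obtain ⟨h, h1⟩ := hx
    obtain ⟨h', h1'⟩ := hx'
    rw [← h1, ← h1']
  · intro D hD x hx y hxy hy
    obtain ⟨c, -, rfl⟩ := mem_image.1 hD
    simp only [f, mem_filter, mem_univ, true_and] at hx ⊢
    obtain ⟨h, h1⟩ := hx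
    have hy' : y ∈ ((S : Set V)ᶜ) := by simpa using hy
    refine ⟨hy', ?_⟩
    rw [← h1, SimpleGraph.ConnectedComponent.eq]
    apply SimpleGraph.Adj.reachable
    simpa using hxy.symm

theorem parts_card_le [Fintype V] (H : SimpleGraph V) (S : Finset V) (C : Finset (Finset V))
    (hC : Parts H S C) : C.card ≤ numComponents H ↑S := by
  have key : ∀ D : C, ∃ x : ((S : Set V)ᶜ : Set V), (x : V) ∈ D.1 := by
    intro D
    obtain ⟨x, hx⟩ := hC.ne D.1 D.2
    exact ⟨⟨x, by simpa using hC.dis D.1 D.2 x hx⟩, hx⟩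
  choose g hg using key
  have hinj : Function.Injective
      (fun D : C => (H.induce ((S : Set V)ᶜ)).connectedComponentMk (g D)) := by
    intro D E h
    simp only [SimpleGraph.ConnectedComponent.eq] at h
    obtain ⟨p⟩ := h
    have hw : ∀ (a b : ((S : Set V)ᶜ : Set V)) (p : (H.induce ((S : Set V)ᶜ)).Walk a b),
        (a : V) ∈ D.1 → (b : V) ∈ D.1 := by
      intro a b p
      induction p with
      | nil => exact id
      | cons h p ih =>
        intro ha
        apply ih
        refine hC.closed D.1 D.2 _ ha _ (by simpa using h) ?_
        rename_i v w
        exact fun h => v.2 (by exact_mod_cast h)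
    have := hw _ _ p (hg D)
    exact Subtype.ext (hC.uniq _ D.2 _ E.2 _ this (hg E))
  have := Nat.card_le_card_of_injective _ hinj
  simpa [numComponents] using this

/-- The neighbours of a set. -/
noncomputable def Nb [Fintype V] (G : SimpleGraph V) (F : Finset V) : Finset V :=
  univ.filter (fun y => y ∉ F ∧ ∃ x ∈ F, G.Adj x y)

/-- The neighbours of a vertex. -/
noncomputable def nb [Fintype V] (G : SimpleGraph V) (u : V) : Finset V :=
  univ.filter (fun y => G.Adj u y)

theorem mem_nb [Fintype V] {G : SimpleGraph V} {u y : V} : y ∈ nb G u ↔ G.Adj u y := by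
  simp [nb]

theorem mem_Nb [Fintype V] {G : SimpleGraph V} {F : Finset V} {y : V} :
    y ∈ Nb G F ↔ y ∉ F ∧ ∃ x ∈ F, G.Adj x y := by
  simp [Nb]

theorem IsCut.two_le [Fintype V] {G : SimpleGraph V} {F W : Finset V} (h : IsCut G F W) :
    2 ≤ numComponents G ↑W := by
  obtain ⟨hne, hd, hcl, z, hz, hz'⟩ := h
  have hP : Parts G W {F, univ \ (F ∪ W)} := by
    constructor
    · intro D hD
      rcases mem_insert.1 hD with rfl | hD
      · exact hne
      · rw [mem_singleton.1 hD]; exact ⟨z, by simp [hz, hz']⟩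
    · intro D hD x hx
      rcases mem_insert.1 hD with rfl | hD
      · exact Finset.disjoint_left.1 hd hx
      · rw [mem_singleton.1 hD] at hx; simp at hx; tauto
    · intro x hx
      by_cases h : x ∈ F
      · exact ⟨F, by simp, h⟩
      · exact ⟨univ \ (F ∪ W), by simp, by simp [h, hx]⟩
    · intro D hD E hE x hx hx'
      simp only [mem_insert, mem_singleton] at hD hE
      rcases hD with rfl | rfl <;> rcases hE with rfl | rfl <;> simp_all
    · intro D hD x hx y hxy hy
      simp only [mem_insert, mem_singleton] at hD
      rcases hD with rfl | rfl
      · exact (hcl x hx y hxy).resolve_right hy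
      · simp only [mem_sdiff, mem_univ, mem_union, true_and, not_or] at hx ⊢
        refine ⟨fun hyF => ?_, hy⟩
        rcases hcl y hyF x hxy.symm with h | h
        · exact hx.1 h
        · exact hx.2 h
  have := parts_card_le G W _ hP
  rw [card_pair] at this
  · exact this
  · rintro rfl'
    have : z ∈ univ \ (F ∪ W) := by simp [hz, hz']
    rw [← rfl'] at this
    exact hz this

theorem IsCut.compl [Fintype V] {G : SimpleGraph V} {F W : Finset V} (h : IsCut G F W) :
    IsCut G (univ \ (F ∪ W)) W := by
  obtain ⟨⟨f, hf⟩, hd, hcl, z, hz, hz'⟩ := h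
  refine ⟨⟨z, by simp [hz, hz']⟩, ?_, ?_, f, ?_, ?_⟩
  · rw [Finset.disjoint_left]; intro x hx; simp at hx; tauto
  · intro x hx y hxy
    simp only [mem_sdiff, mem_univ, mem_union, true_and, not_or] at hx ⊢
    by_cases hyF : y ∈ F
    · rcases hcl y hyF x hxy.symm with h | h
      · exact absurd h hx.1
      · exact absurd h hx.2
    · tauto
  · simp [hf]
  · exact Finset.disjoint_left.1 hd hf

theorem IsCut.corner [Fintype V] {G : SimpleGraph V} {A T F W : Finset V} (h : IsCut G A T)
    (h' : IsCut G F W) (hne : (A ∩ F).Nonempty) :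
    IsCut G (A ∩ F) (W ∩ A ∪ W ∩ T ∪ T ∩ F) := by
  obtain ⟨-, hd, hcl, z, hz, hz'⟩ := h
  obtain ⟨-, hd', hcl', -⟩ := h'
  rw [Finset.disjoint_left] at hd hd'
  refine ⟨hne, ?_, ?_, z, by simp [hz], by simp [hz, hz']⟩
  · rw [Finset.disjoint_left]
    intro x hx
    have := @hd x
    have := @hd' x
    simp only [mem_inter, mem_union] at hx ⊢
    tauto
  · intro x hx y hxy
    simp only [mem_inter, mem_union] at hx ⊢
    have := hcl x hx.1 y hxy
    have := hcl' x hx.2 y hxy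
    tauto

theorem card_three [Fintype V] {A T : Finset V} (hd : Disjoint A T) (Z : Finset V) :
    Z.card = (Z ∩ A).card + (Z ∩ T).card + (Z ∩ (univ \ (A ∪ T))).card := by
  rw [Finset.disjoint_left] at hd
  rw [← card_union_of_disjoint, ← card_union_of_disjoint]
  · congr 1
    ext x
    simp only [mem_inter, mem_union, mem_sdiff, mem_univ, true_and]
    tauto
  · rw [Finset.disjoint_left]; intro x; simp only [mem_inter, mem_union, mem_sdiff, mem_univ, true_and]
    tauto
  · rw [Finset.disjoint_left]; intro x
    have := @hd x
    simp only [mem_inter]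
    tauto

theorem card_corner_le (A T F W : Finset V) :
    (W ∩ A ∪ W ∩ T ∪ T ∩ F).card ≤ (W ∩ A).card + (W ∩ T).card + (T ∩ F).card := by
  refine (card_union_le _ _).trans ?_
  have := card_union_le (W ∩ A) (W ∩ T)
  omega

/-- `A` with boundary `T` is an atom with respect to cuts of size `k`. -/
structure Atom (G : SimpleGraph V) (k : ℕ) (A T : Finset V) : Prop where
  conn : ∀ F W, IsCut G F W → k ≤ W.card
  cut : IsCut G A T
  card : T.card = k
  min : ∀ F W, IsCut G F W → W.card ≤ k → A.card ≤ F.card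

theorem Atom.no_cut [Fintype V] {G : SimpleGraph V} {k : ℕ} {A T : Finset V}
    (h : Atom G k A T) (hA : k < 2 * A.card) {F W : Finset V} (hc : IsCut G F W)
    {a : V} (ha : a ∈ A) (haW : a ∈ W) : k + 1 ≤ W.card := by
  by_contra hlt
  have hW : W.card = k := le_antisymm (by omega) (h.conn _ _ hc)
  have hdA := h.cut.2.1
  have key : ∀ F, IsCut G F W → A ∩ F = ∅ := by
    intro F hc
    by_contra hne
    have hne : (A ∩ F).Nonempty := nonempty_iff_ne_empty.2 hne
    have hc1 := h.cut.corner hc hne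
    have hdF := hc.2.1
    have hle := card_corner_le A T F W
    have hT := card_three hdF T
    have hW3 := card_three hdA W
    have hTk := h.card
    -- the corner is a proper subset of `A`
    have h1 : k + 1 ≤ (W ∩ A ∪ W ∩ T ∪ T ∩ F).card := by
      by_contra hlt'
      have := h.min _ _ hc1 (by omega)
      have hss : A ∩ F ⊂ A := by
        refine Finset.ssubset_iff_subset_ne.2 ⟨inter_subset_left, fun he => ?_⟩
        rw [← he] at ha
        exact (Finset.disjoint_left.1 hdF (mem_inter.1 ha).2) haW
      have := card_lt_card hss
      omega
    have hemp : (univ \ (A ∪ T)) ∩ (univ \ (F ∪ W)) = ∅ := by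
      by_contra hne2
      have hc2 := h.cut.compl.corner hc.compl (nonempty_iff_ne_empty.2 hne2)
      have := h.conn _ _ hc2
      have := card_corner_le (univ \ (A ∪ T)) T (univ \ (F ∪ W)) W
      rw [inter_comm W T] at *
      omega
    have hE := card_three hdA (univ \ (F ∪ W))
    rw [inter_comm _ (univ \ (A ∪ T)), hemp, card_empty] at hE
    have h5 := h.min _ _ hc.compl hW.le
    have hA3 := card_three hdF A
    rw [inter_comm _ A, inter_comm _ T] at hE
    rw [inter_comm A W] at hA3
    rw [inter_comm T W] at hT
    have : 0 < (A ∩ F).card := hne.card_pos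
    omega
  have hF := key F hc
  have hE := key _ hc.compl
  have hA3 := card_three hc.2.1 A
  rw [hF, hE, card_empty] at hA3
  have half : ∀ F, IsCut G F W → A ∩ F = ∅ → A.card ≤ (T ∩ F).card := by
    intro F hc hF
    by_cases hne : ((univ \ (A ∪ T)) ∩ F).Nonempty
    · have hc2 := h.cut.compl.corner hc hne
      have h1 := h.conn _ _ hc2
      have h2 := card_corner_le (univ \ (A ∪ T)) T F W
      have h3 := card_three hdA W
      rw [inter_comm A W] at hA3
      omega
    · have h3 := card_three hdA F
      rw [inter_comm F A, hF, inter_comm _ (univ \ (A ∪ T)), not_nonempty_iff_eq_empty.1 hne,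
        inter_comm F T] at h3
      have := h.min _ _ hc hW.le
      simp at h3
      omega
  have h1 := half _ hc hF
  have h2 := half _ hc.compl hE
  have h3 := card_three hc.2.1 T
  have := h.card
  omega

/-- The structure attached to an edge `uv` by minimal toughness (when both ends become
isolated vertices after deleting the cut and the edge). -/
structure EdgeData [Fintype V] (G : SimpleGraph V) (k : ℕ) (u v : V)
    (C : Finset (Finset V)) : Prop where
  ne : ∀ D ∈ C, D.Nonempty
  sep : ∀ D ∈ C, ∀ E ∈ C, D ≠ E → ∀ x ∈ D, ∀ y ∈ E, x ≠ y ∧ ¬ G.Adj x y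
  u_notMem : ∀ D ∈ C, u ∉ D
  v_notMem : ∀ D ∈ C, v ∉ D
  u_Nb : ∀ D ∈ C, u ∉ Nb G D
  v_Nb : ∀ D ∈ C, v ∉ Nb G D
  ineq : ∑ D ∈ C, (Nb G D).card + 2 * (nb G u).card + (nb G v).card ≤
    k * C.card + 2 * k + 2 + (nb G u ∩ nb G v).card + (nb G u ∩ C.biUnion (Nb G)).card

theorem EdgeData.cut [Fintype V] {G : SimpleGraph V} {k : ℕ} {u v : V}
    {C : Finset (Finset V)} (h : EdgeData G k u v C) {D : Finset V} (hD : D ∈ C) :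
    IsCut G D (Nb G D) := by
  refine ⟨h.ne D hD, ?_, ?_, u, h.u_notMem D hD, h.u_Nb D hD⟩
  · rw [Finset.disjoint_left]; intro x hx hx'
    exact (mem_Nb.1 hx').1 hx
  · intro x hx y hxy
    by_cases hy : y ∈ D
    · exact Or.inl hy
    · exact Or.inr (mem_Nb.2 ⟨hy, x, hx, hxy⟩)

theorem sum_ge {α : Type*} (C : Finset α) (f : α → ℕ) (k : ℕ) (h : ∀ D ∈ C, k ≤ f D) :
    k * C.card ≤ ∑ D ∈ C, f D := by
  have := Finset.card_nsmul_le_sum C f k h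
  rw [smul_eq_mul, mul_comm] at this
  exact this

theorem sum_ge_add {α : Type*} (C : Finset α) (f : α → ℕ) (k : ℕ) (h : ∀ D ∈ C, k ≤ f D)
    {E : α} (hE : E ∈ C) : k * C.card + f E ≤ ∑ D ∈ C, f D + k := by
  have h1 := sum_ge (C.erase E) f k (fun D hD => h D (mem_of_mem_erase hD))
  have h2 := Finset.add_sum_erase C f hE
  have h3 := Finset.card_erase_add_one hE
  have h4 : k * C.card = k * (C.erase E).card + k := by rw [← h3]; ring
  omega

section Main

variable [Fintype V] {G : SimpleGraph V} {k : ℕ} {A T : Finset V}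

theorem EdgeData.codeg (hconn : ∀ F W, IsCut G F W → k ≤ W.card) {u v : V} (huv : G.Adj u v)
    {C : Finset (Finset V)} (h : EdgeData G k u v C) :
    (nb G u).card + (nb G v).card ≤ 2 * k + 1 + (nb G u ∩ nb G v).card := by
  have h1 := sum_ge C (fun D => (Nb G D).card) k (fun D hD => hconn _ _ (h.cut hD))
  have h2 := h.ineq
  have h3 : (nb G u ∩ C.biUnion (Nb G)).card < (nb G u).card := by
    apply card_lt_card
    refine Finset.ssubset_iff_subset_ne.2 ⟨inter_subset_left, fun he => ?_⟩
    have : v ∈ nb G u := mem_nb.2 huv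
    rw [← he] at this
    obtain ⟨D, hD, hv⟩ := mem_biUnion.1 (mem_inter.1 this).2
    exact h.v_Nb D hD hv
  omega

theorem rich {u y d : V} (huy : G.Adj u y) (hyd : G.Adj y d) (hud : u ≠ d) (hn : ¬ G.Adj u d)
    (h1 : (nb G u).card + (nb G y).card ≤ 2 * k + 1 + (nb G u ∩ nb G y).card)
    (h2 : (nb G y).card + (nb G d).card ≤ 2 * k + 1 + (nb G y ∩ nb G d).card) :
    (nb G u).card + (nb G y).card + (nb G d).card + 1 ≤ 4 * k + (nb G u ∩ nb G d).card := by
  have e1 : (insert u (nb G u ∩ nb G y)).card = (nb G u ∩ nb G y).card + 1 :=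
    card_insert_of_notMem (by simp [mem_nb])
  have e2 : (insert d (nb G y ∩ nb G d)).card = (nb G y ∩ nb G d).card + 1 :=
    card_insert_of_notMem (by simp [mem_nb])
  have e3 := card_union_add_card_inter (insert u (nb G u ∩ nb G y)) (insert d (nb G y ∩ nb G d))
  have e4 : (insert u (nb G u ∩ nb G y) ∪ insert d (nb G y ∩ nb G d)).card ≤ (nb G y).card := by
    apply card_le_card
    intro z
    simp only [mem_union, mem_insert, mem_inter, mem_nb]
    rintro ((rfl | h) | (rfl | h))
    · exact huy.symm
    · exact h.2
    · exact hyd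
    · exact h.1
  have e5 : (insert u (nb G u ∩ nb G y) ∩ insert d (nb G y ∩ nb G d)).card + 1
      ≤ (nb G u ∩ nb G d).card := by
    have : y ∉ insert u (nb G u ∩ nb G y) ∩ insert d (nb G y ∩ nb G d) := by
      simp only [mem_inter, mem_insert, mem_nb]
      rintro ⟨rfl | h, -⟩
      · exact huy.ne rfl
      · exact h.2.ne rfl
    rw [← card_insert_of_notMem this]
    apply card_le_card
    intro z
    simp only [mem_inter, mem_insert, mem_nb]
    rintro (rfl | ⟨rfl | h, rfl | h'⟩)
    · exact ⟨huy, hyd.symm⟩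
    · exact absurd rfl hud
    · exact absurd h'.2.symm hn
    · exact absurd h.1 hn
    · exact ⟨h.1, h'.2⟩
  omega

theorem rich_M (hA : Atom G k A T)
    (hE : ∀ u ∈ A, ∀ v, G.Adj u v → ∃ C, EdgeData G k u v C)
    {u v : V} (hu : u ∈ A) {C : Finset (Finset V)} (h : EdgeData G k u v C)
    {D : Finset V} (hD : D ∈ C) {y : V} (hy : y ∈ nb G u ∩ Nb G D) (hyA : y ∈ A) :
    ∃ d ∈ D, G.Adj y d ∧
      (nb G u).card + (nb G y).card + (nb G d).card + 1 ≤ 4 * k + (nb G u ∩ Nb G D).card := by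
  obtain ⟨hy1, hy2⟩ := mem_inter.1 hy
  obtain ⟨-, d, hd, hdy⟩ := mem_Nb.1 hy2
  have huy := mem_nb.1 hy1
  have hud : u ≠ d := fun he => h.u_notMem D hD (he ▸ hd)
  have hn : ¬ G.Adj u d := fun ha =>
    h.u_Nb D hD (mem_Nb.2 ⟨h.u_notMem D hD, d, hd, ha.symm⟩)
  obtain ⟨C1, hC1⟩ := hE u hu y huy
  obtain ⟨C2, hC2⟩ := hE y hyA d hdy.symm
  have := rich huy hdy.symm hud hn (hC1.codeg hA.conn huy) (hC2.codeg hA.conn hdy.symm)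
  refine ⟨d, hd, hdy.symm, this.trans ?_⟩
  have : (nb G u ∩ nb G d).card ≤ (nb G u ∩ Nb G D).card := by
    apply card_le_card
    intro z hz
    obtain ⟨hz1, hz2⟩ := mem_inter.1 hz
    refine mem_inter.2 ⟨hz1, mem_Nb.2 ⟨fun hzD => ?_, d, hd, mem_nb.1 hz2⟩⟩
    exact h.u_Nb D hD (mem_Nb.2 ⟨h.u_notMem D hD, z, hzD, (mem_nb.1 hz1).symm⟩)
  omega

theorem M_disjoint (hcf : ClawFree G) {u v : V} {C : Finset (Finset V)}
    (h : EdgeData G k u v C) {D D' : Finset V} (hD : D ∈ C) (hD' : D' ∈ C) (hne : D ≠ D') :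
    Disjoint (nb G u ∩ Nb G D) (nb G u ∩ Nb G D') := by
  rw [Finset.disjoint_left]
  intro z hz hz'
  obtain ⟨hz1, hz2⟩ := mem_inter.1 hz
  obtain ⟨-, d, hd, hdz⟩ := mem_Nb.1 hz2
  obtain ⟨-, d', hd', hdz'⟩ := mem_Nb.1 (mem_inter.1 hz').2
  obtain ⟨h1, h2⟩ := h.sep D hD D' hD' hne d hd d' hd'
  refine hcf ⟨z, u, d, d', ?_, ?_, h1, (mem_nb.1 hz1).symm, hdz.symm, hdz'.symm, ?_, ?_, h2⟩
  · rintro rfl; exact h.u_notMem D hD hd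
  · rintro rfl; exact h.u_notMem D' hD' hd'
  · exact fun ha => h.u_Nb D hD (mem_Nb.2 ⟨h.u_notMem D hD, d, hd, ha.symm⟩)
  · exact fun ha => h.u_Nb D' hD' (mem_Nb.2 ⟨h.u_notMem D' hD', d', hd', ha.symm⟩)

theorem M_unique (hk : 4 ≤ k) (hdeg : ∀ v, 5 * k ≤ 3 * (nb G v).card + 2) (hcf : ClawFree G)
    (hA : Atom G k A T) (hE : ∀ u ∈ A, ∀ v, G.Adj u v → ∃ C, EdgeData G k u v C)
    {u v : V} (hu : u ∈ A) (huv : G.Adj u v)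
    {C : Finset (Finset V)} (h : EdgeData G k u v C)
    {D : Finset V} (hD : D ∈ C) {y : V} (hy : y ∈ nb G u ∩ Nb G D) (hyA : y ∈ A)
    {D' : Finset V} (hD' : D' ∈ C) {y' : V} (hy' : y' ∈ nb G u ∩ Nb G D') (hyA' : y' ∈ A) :
    D = D' := by
  by_contra hne
  obtain ⟨d, -, -, h1⟩ := rich_M hA hE hu h hD hy hyA
  obtain ⟨d', -, -, h2⟩ := rich_M hA hE hu h hD' hy' hyA'
  have h3 := card_union_of_disjoint (M_disjoint hcf h hD hD' hne)
  have h4 : (nb G u ∩ Nb G D ∪ nb G u ∩ Nb G D').card < (nb G u).card := by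
    apply card_lt_card
    refine Finset.ssubset_iff_subset_ne.2
      ⟨union_subset inter_subset_left inter_subset_left, fun he => ?_⟩
    have : v ∈ nb G u := mem_nb.2 huv
    rw [← he] at this
    rcases mem_union.1 this with h5 | h5
    · exact h.v_Nb D hD (mem_inter.1 h5).2
    · exact h.v_Nb D' hD' (mem_inter.1 h5).2
  have := hdeg u
  have := hdeg y
  have := hdeg y'
  have := hdeg d
  have := hdeg d'
  omega

/-- Vertices in the boundary have neighbours on both sides. -/
theorem Atom.nbr_in (hA : Atom G k A T) {v : V} (hv : v ∈ T) : ∃ a ∈ A, G.Adj a v := by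
  by_contra hcon
  push Not at hcon
  obtain ⟨hne, hd, hcl, z, hz, hz'⟩ := hA.cut
  have hc : IsCut G A (T.erase v) := by
    refine ⟨hne, hd.mono_right (erase_subset _ _), ?_, z, hz, fun h => hz' (mem_of_mem_erase h)⟩
    intro x hx y hxy
    rcases hcl x hx y hxy with h | h
    · exact Or.inl h
    · refine Or.inr (mem_erase.2 ⟨?_, h⟩)
      rintro rfl
      exact hcon x hx hxy
  have h1 := hA.conn _ _ hc
  have h2 := card_erase_add_one hv
  have := hA.card
  omega

theorem Atom.nbr_out (hA : Atom G k A T) {v : V} (hv : v ∈ T) :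
    ∃ a, a ∉ A ∧ a ∉ T ∧ G.Adj v a := by
  by_contra hcon
  push Not at hcon
  obtain ⟨hne, hd, hcl, z, hz, hz'⟩ := hA.cut.compl
  have hc : IsCut G (univ \ (A ∪ T)) (T.erase v) := by
    refine ⟨hne, hd.mono_right (erase_subset _ _), ?_, z, hz, fun h => hz' (mem_of_mem_erase h)⟩
    intro x hx y hxy
    rcases hcl x hx y hxy with h | h
    · exact Or.inl h
    · refine Or.inr (mem_erase.2 ⟨?_, h⟩)
      rintro rfl
      simp only [mem_sdiff, mem_univ, mem_union, true_and, not_or] at hx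
      exact hcon x hx.1 hx.2 hxy.symm
  have h1 := hA.conn _ _ hc
  have h2 := card_erase_add_one hv
  have := hA.card
  omega

theorem has_T_nbr (hk : 4 ≤ k) (hdeg : ∀ v, 5 * k ≤ 3 * (nb G v).card + 2) (hcf : ClawFree G)
    (hA : Atom G k A T) (hE : ∀ u ∈ A, ∀ v, G.Adj u v → ∃ C, EdgeData G k u v C)
    {u : V} (hu : u ∈ A) : ∃ v ∈ T, G.Adj u v := by
  by_contra hcon
  push Not at hcon
  have hNA : ∀ y, G.Adj u y → y ∈ A := by
    intro y huy
    rcases hA.cut.2.2.1 u hu y huy with h | h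
    · exact h
    · exact absurd huy (hcon y h)
  have hout : ∀ w, G.Adj u w →
      (nb G w).card + 2 * (nb G u).card ≤ 3 * k + 2 + (nb G u ∩ nb G w).card := by
    intro w huw
    obtain ⟨C, h⟩ := hE u hu w huw
    have h2 := h.ineq
    by_cases hex : ∃ D ∈ C, (nb G u ∩ Nb G D).Nonempty
    · obtain ⟨D, hD, y, hy⟩ := hex
      have h1 := sum_ge_add C (fun D => (Nb G D).card) k
        (fun D hD => hA.conn _ _ (h.cut hD)) hD
      have h3 : (nb G u ∩ C.biUnion (Nb G)).card ≤ (Nb G D).card := by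
        apply card_le_card
        intro z hz
        obtain ⟨hz1, hz2⟩ := mem_inter.1 hz
        obtain ⟨D', hD', hz'⟩ := mem_biUnion.1 hz2
        rw [M_unique hk hdeg hcf hA hE hu huw h hD hy (hNA _ (mem_nb.1 (mem_inter.1 hy).1)) hD'
          (mem_inter.2 ⟨hz1, hz'⟩) (hNA _ (mem_nb.1 hz1))]
        exact hz'
      omega
    · have h1 := sum_ge C (fun D => (Nb G D).card) k (fun D hD => hA.conn _ _ (h.cut hD))
      have h3 : nb G u ∩ C.biUnion (Nb G) = ∅ := by
        rw [← not_nonempty_iff_eq_empty]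
        rintro ⟨z, hz⟩
        obtain ⟨hz1, hz2⟩ := mem_inter.1 hz
        obtain ⟨D', hD', hz'⟩ := mem_biUnion.1 hz2
        exact hex ⟨D', hD', z, mem_inter.2 ⟨hz1, hz'⟩⟩
      rw [h3, card_empty] at h2
      omega
  obtain ⟨-, hd, hcl, z, hz, hz'⟩ := hA.cut
  have hc : IsCut G (insert u (nb G u)) (Nb G (insert u (nb G u))) := by
    refine ⟨⟨u, by simp⟩, ?_, ?_, z, ?_, ?_⟩
    · rw [Finset.disjoint_left]; intro x hx hx'
      exact (mem_Nb.1 hx').1 hx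
    · intro x hx y hxy
      by_cases hy : y ∈ insert u (nb G u)
      · exact Or.inl hy
      · exact Or.inr (mem_Nb.2 ⟨hy, x, hx, hxy⟩)
    · simp only [mem_insert, mem_nb, not_or]
      exact ⟨fun he => hz (he ▸ hu), fun ha => hz (hNA _ ha)⟩
    · intro hzN
      obtain ⟨-, x, hx, hxz⟩ := mem_Nb.1 hzN
      have hxA : x ∈ A := by
        rcases mem_insert.1 hx with rfl | hx
        · exact hu
        · exact hNA _ (mem_nb.1 hx)
      rcases hcl x hxA z hxz with h | h
      · exact hz h
      · exact hz' h
  have hR := hA.conn _ _ hc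
  obtain ⟨r1, h1, r2, h2, r3, h3, h12, h13, h23⟩ :=
    Finset.two_lt_card.1 (show 2 < (Nb G (insert u (nb G u))).card by omega)
  have hrich : ∀ r ∈ Nb G (insert u (nb G u)),
      5 * k ≤ 4 * k + (nb G u ∩ nb G r).card + 1 ∧ ¬ G.Adj u r ∧ r ≠ u := by
    intro r hr
    obtain ⟨hr1, y, hy, hyr⟩ := mem_Nb.1 hr
    simp only [mem_insert, mem_nb, not_or] at hr1 hy
    have huy : G.Adj u y := by
      rcases hy with rfl | hy
      · exact absurd hyr hr1.2
      · exact hy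
    obtain ⟨C1, hC1⟩ := hE u hu y huy
    obtain ⟨C2, hC2⟩ := hE y (hNA y huy) r hyr
    have := rich huy hyr (Ne.symm hr1.1) hr1.2 (hC1.codeg hA.conn huy) (hC2.codeg hA.conn hyr)
    have := hdeg u
    have := hdeg y
    have := hdeg r
    exact ⟨by omega, hr1.2, hr1.1⟩
  have hdis : ∀ r ∈ Nb G (insert u (nb G u)), ∀ r' ∈ Nb G (insert u (nb G u)), r ≠ r' →
      Disjoint (nb G u ∩ nb G r) (nb G u ∩ nb G r') := by
    intro r hr r' hr' hne
    rw [Finset.disjoint_left]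
    intro w hw hw'
    simp only [mem_inter, mem_nb] at hw hw'
    have ho := hout w hw.1
    have h4 : (insert u (insert r (insert r' (nb G u ∩ nb G w)))).card ≤ (nb G w).card := by
      apply card_le_card
      intro x
      simp only [mem_insert, mem_inter, mem_nb]
      rintro (rfl | rfl | rfl | hx)
      · exact hw.1.symm
      · exact hw.2.symm
      · exact hw'.2.symm
      · exact hx.2
    obtain ⟨-, hur, hru⟩ := hrich r hr
    obtain ⟨-, hur', hru'⟩ := hrich r' hr'
    rw [card_insert_of_notMem (by simp [mem_nb, Ne.symm hru, Ne.symm hru']),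
      card_insert_of_notMem (by simp [mem_nb, hne, hur]),
      card_insert_of_notMem (by simp [mem_nb, hur'])] at h4
    have := hdeg u
    omega
  have hs : (nb G u ∩ nb G r1 ∪ nb G u ∩ nb G r2 ∪ nb G u ∩ nb G r3).card ≤ (nb G u).card :=
    card_le_card (union_subset (union_subset inter_subset_left inter_subset_left)
      inter_subset_left)
  rw [card_union_of_disjoint (disjoint_union_left.2 ⟨hdis _ h1 _ h3 h13, hdis _ h2 _ h3 h23⟩),
    card_union_of_disjoint (hdis _ h1 _ h2 h12)] at hs
  have := (hrich _ h1).1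
  have := (hrich _ h2).1
  have := (hrich _ h3).1
  obtain ⟨x, hx⟩ : (nb G u).Nonempty := by
    rw [← card_pos]
    have := hdeg u
    omega
  have ho := hout x (mem_nb.1 hx)
  have hcc : (nb G u ∩ nb G x).card + 1 ≤ (nb G x).card := by
    rw [← card_insert_of_notMem (a := u) (by simp [mem_nb])]
    apply card_le_card
    intro y
    simp only [mem_insert, mem_inter, mem_nb]
    rintro (rfl | hy)
    · exact (mem_nb.1 hx).symm
    · exact hy.2
  omega

theorem main_false (hk : 4 ≤ k) (hdeg : ∀ v, 5 * k ≤ 3 * (nb G v).card + 2) (hcf : ClawFree G)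
    (hA : Atom G k A T) (hE : ∀ u ∈ A, ∀ v, G.Adj u v → ∃ C, EdgeData G k u v C) : False := by
  obtain ⟨u, hu, hmin⟩ := Finset.exists_min_image A (fun u => (T ∩ nb G u).card) hA.cut.1
  obtain ⟨v, hvT, huv⟩ := has_T_nbr hk hdeg hcf hA hE hu
  obtain ⟨C, h⟩ := hE u hu v huv
  have hineq := h.ineq
  have hTk := hA.card
  have hdA := hA.cut.2.1
  have hdA' := Finset.disjoint_left.1 hdA
  have hdu := hdeg u
  -- `v` has a neighbour outside
  have hc : (nb G u ∩ nb G v).card + 2 ≤ (nb G v).card := by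
    obtain ⟨b, hbA, hbT, hvb⟩ := hA.nbr_out hvT
    have hub : ¬ G.Adj u b := by
      intro ha
      rcases hA.cut.2.2.1 u hu b ha with h | h
      · exact hbA h
      · exact hbT h
    have : (insert u (insert b (nb G u ∩ nb G v))).card ≤ (nb G v).card := by
      apply card_le_card
      intro x
      simp only [mem_insert, mem_inter, mem_nb]
      rintro (rfl | rfl | hx)
      · exact huv.symm
      · exact hvb
      · exact hx.2
    rw [card_insert_of_notMem, card_insert_of_notMem (by simp [mem_nb, hub])] at this
    · exact this
    · simp only [mem_insert, mem_inter, mem_nb, not_or]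
      refine ⟨?_, by simp⟩
      rintro rfl
      exact hbA hu
  have hvTu : v ∈ T ∩ nb G u := mem_inter.2 ⟨hvT, mem_nb.2 huv⟩
  have hTu := card_erase_add_one hvTu
  have hZT : ∀ z ∈ nb G u ∩ C.biUnion (Nb G), z ∈ A ∨ z ∈ (T ∩ nb G u).erase v := by
    intro z hz
    obtain ⟨hz1, hz2⟩ := mem_inter.1 hz
    obtain ⟨D', hD', hz'⟩ := mem_biUnion.1 hz2
    rcases hA.cut.2.2.1 u hu z (mem_nb.1 hz1) with h1 | h1
    · exact Or.inl h1
    · refine Or.inr (mem_erase.2 ⟨?_, mem_inter.2 ⟨h1, hz1⟩⟩)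
      rintro rfl
      exact h.v_Nb D' hD' hz'
  by_cases hex : ∃ D ∈ C, ∃ y ∈ nb G u ∩ Nb G D, y ∈ A
  swap
  · have h1 := sum_ge C (fun D => (Nb G D).card) k (fun D hD => hA.conn _ _ (h.cut hD))
    have h2 : (nb G u ∩ C.biUnion (Nb G)).card ≤ ((T ∩ nb G u).erase v).card := by
      apply card_le_card
      intro z hz
      rcases hZT z hz with h1 | h1
      · obtain ⟨hz1, hz2⟩ := mem_inter.1 hz
        obtain ⟨D', hD', hz'⟩ := mem_biUnion.1 hz2
        exact absurd ⟨D', hD', z, mem_inter.2 ⟨hz1, hz'⟩, h1⟩ hex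
      · exact h1
    have h3 : (T ∩ nb G u).card ≤ T.card := card_le_card inter_subset_left
    omega
  obtain ⟨D, hD, y, hy, hyA⟩ := hex
  have hcut := h.cut hD
  have hsum := sum_ge_add C (fun D => (Nb G D).card) k
    (fun D hD => hA.conn _ _ (h.cut hD)) hD
  have hZ : (nb G u ∩ C.biUnion (Nb G)).card ≤ (Nb G D ∩ A).card + ((T ∩ nb G u).erase v).card := by
    refine le_trans (card_le_card ?_) (card_union_le _ _)
    intro z hz
    rcases hZT z hz with h1 | h1
    · obtain ⟨hz1, hz2⟩ := mem_inter.1 hz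
      obtain ⟨D', hD', hz'⟩ := mem_biUnion.1 hz2
      rw [← M_unique hk hdeg hcf hA hE hu huv h hD hy hyA hD' (mem_inter.2 ⟨hz1, hz'⟩) h1] at hz'
      exact mem_union_left _ (mem_inter.2 ⟨hz', h1⟩)
    · exact mem_union_right _ h1
  have hN3 := card_three hdA (Nb G D)
  have hT3 := card_three hcut.2.1 T
  have hTD : (T ∩ nb G u).card + (T ∩ D).card ≤ k := by
    rw [← hTk, ← card_union_of_disjoint]
    · exact card_le_card (union_subset inter_subset_left inter_subset_left)
    · rw [Finset.disjoint_left]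
      intro z hz hz'
      refine h.u_Nb D hD (mem_Nb.2 ⟨h.u_notMem D hD, z, (mem_inter.1 hz').2, ?_⟩)
      exact (mem_nb.1 (mem_inter.1 hz).2).symm
  by_cases hDB : ((univ \ (A ∪ T)) ∩ D).Nonempty
  · have h1 := hA.conn _ _ (hA.cut.compl.corner hcut hDB)
    have h2 := card_corner_le (univ \ (A ∪ T)) T D (Nb G D)
    omega
  -- now `D` is contained in `A ∪ T`
  have hDAT : ∀ x ∈ D, x ∈ A ∨ x ∈ T := by
    intro x hx
    by_contra hcon
    exact hDB ⟨x, by simp only [mem_inter, mem_sdiff, mem_univ, mem_union, true_and]; tauto⟩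
  obtain ⟨d, hdD, hyd, hrich⟩ := rich_M hA hE hu h hD hy hyA
  have hdd := hdeg d
  have hdy := hdeg y
  have hAcard : (nb G u).card + 1 ≤ A.card + k := by
    rw [← hTk, ← card_insert_of_notMem (a := u) (s := nb G u) (by simp [mem_nb])]
    refine le_trans (card_le_card ?_) (card_union_le _ _)
    intro z hz
    rcases mem_insert.1 hz with rfl | hz
    · exact mem_union_left _ hu
    · exact mem_union.2 (hA.cut.2.2.1 u hu z (mem_nb.1 hz))
  have hZu : (nb G u ∩ C.biUnion (Nb G)).card + 1 ≤ (nb G u).card := by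
    rw [← card_insert_of_notMem (a := v)]
    · apply card_le_card
      intro z hz
      rcases mem_insert.1 hz with rfl | hz
      · exact mem_nb.2 huv
      · exact (mem_inter.1 hz).1
    · intro hv
      obtain ⟨D', hD', hz'⟩ := mem_biUnion.1 (mem_inter.1 hv).2
      exact h.v_Nb D' hD' hz'
  have hNB : (T ∩ D).card ≤ (Nb G D ∩ (univ \ (A ∪ T))).card := by
    by_cases hne : ((univ \ (A ∪ T)) ∩ (univ \ (D ∪ Nb G D))).Nonempty
    · have h1 := hA.conn _ _ (hA.cut.compl.corner hcut.compl hne)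
      have h2 := card_corner_le (univ \ (A ∪ T)) T (univ \ (D ∪ Nb G D)) (Nb G D)
      rw [inter_comm T (Nb G D)] at hT3
      omega
    · exfalso
      have h1 : univ \ (A ∪ T) ⊆ Nb G D ∩ (univ \ (A ∪ T)) := by
        intro z hz
        refine mem_inter.2 ⟨?_, hz⟩
        by_contra hzN
        by_cases hzD : z ∈ D
        · exact hDB ⟨z, mem_inter.2 ⟨hz, hzD⟩⟩
        · exact hne ⟨z, mem_inter.2 ⟨hz, by simp [hzD, hzN]⟩⟩
      have h2 := card_le_card h1
      have h3 := hA.min _ _ hA.cut.compl hTk.le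
      have h4 : (nb G u ∩ Nb G D).card ≤ (Nb G D ∩ A).card + (Nb G D ∩ T).card := by
        refine le_trans (card_le_card ?_) (card_union_le _ _)
        intro z hz
        obtain ⟨hz1, hz2⟩ := mem_inter.1 hz
        rcases hA.cut.2.2.1 u hu z (mem_nb.1 hz1) with h1 | h1
        · exact mem_union_left _ (mem_inter.2 ⟨hz2, h1⟩)
        · exact mem_union_right _ (mem_inter.2 ⟨hz2, h1⟩)
      omega
  by_cases hDA : ∃ e ∈ D, e ∈ A
  · obtain ⟨e, heD, heA⟩ := hDA
    have h1 := hmin e heA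
    have h2 : (T ∩ nb G e).card ≤ (T ∩ D).card + (Nb G D ∩ T).card := by
      refine le_trans (card_le_card ?_) (card_union_le _ _)
      intro z hz
      obtain ⟨hz1, hz2⟩ := mem_inter.1 hz
      by_cases hzD : z ∈ D
      · exact mem_union_left _ (mem_inter.2 ⟨hz1, hzD⟩)
      · exact mem_union_right _ (mem_inter.2 ⟨mem_Nb.2 ⟨hzD, e, heD, mem_nb.1 hz2⟩, hz1⟩)
    omega
  · push Not at hDA
    have h1 : (nb G d).card + 1 ≤ (T ∩ D).card + (Nb G D).card := by
      rw [← card_insert_of_notMem (a := d) (s := nb G d) (by simp [mem_nb])]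
      refine le_trans (card_le_card ?_) (card_union_le _ _)
      have hDT : ∀ x ∈ D, x ∈ T ∩ D := fun x hx =>
        mem_inter.2 ⟨(hDAT x hx).resolve_left (hDA x hx), hx⟩
      intro z hz
      rcases mem_insert.1 hz with rfl | hz
      · exact mem_union_left _ (hDT _ hdD)
      · by_cases hzD : z ∈ D
        · exact mem_union_left _ (hDT _ hzD)
        · exact mem_union_right _ (mem_Nb.2 ⟨hzD, d, hdD, mem_nb.1 hz⟩)
    omega

end Main

section Edge

theorem claw3 {G : SimpleGraph V} (hcf : ClawFree G) {y a b c : V}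
    (hab : a ≠ b ∧ ¬ G.Adj a b) (hac : a ≠ c ∧ ¬ G.Adj a c) (hbc : b ≠ c ∧ ¬ G.Adj b c)
    (ha : G.Adj y a) (hb : G.Adj y b) (hc : G.Adj y c) : False :=
  hcf ⟨y, a, b, c, hab.1, hac.1, hbc.1, ha, hb, hc, hab.2, hac.2, hbc.2⟩

theorem dcount [Fintype V] {G : SimpleGraph V} (S : Finset V) (C : Finset (Finset V))
    (h : ∀ D ∈ C, Nb G D ⊆ S) :
    ∑ D ∈ C, (Nb G D).card = ∑ y ∈ S, (C.filter (fun D => y ∈ Nb G D)).card := by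
  simp only [card_filter]
  rw [sum_comm]
  refine sum_congr rfl fun D hD => ?_
  rw [← card_filter]
  congr 1
  ext y
  simp only [mem_filter]
  exact ⟨fun hy => ⟨h D hD hy, hy⟩, fun hy => hy.2⟩

/-- The classes of `G - e - S` where `e = uv` joins the classes `Cu` and `Cv`. -/
structure Setup (G : SimpleGraph V) (S : Finset V) (u v : V) (Cu Cv : Finset V)
    (C : Finset (Finset V)) : Prop where
  ne : ∀ D ∈ C, D.Nonempty
  dis : ∀ D ∈ C, ∀ x ∈ D, x ∉ S
  disu : ∀ x ∈ Cu, x ∉ S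
  disv : ∀ x ∈ Cv, x ∉ S
  cov : ∀ x, x ∉ S → x ∈ Cu ∨ x ∈ Cv ∨ ∃ D ∈ C, x ∈ D
  sep : ∀ D ∈ C, ∀ E ∈ C, D ≠ E → ∀ x ∈ D, ∀ y ∈ E, x ≠ y ∧ ¬ G.Adj x y
  sepu : ∀ D ∈ C, ∀ x ∈ D, ∀ y ∈ Cu, x ≠ y ∧ ¬ G.Adj x y
  sepv : ∀ D ∈ C, ∀ x ∈ D, ∀ y ∈ Cv, x ≠ y ∧ ¬ G.Adj x y
  sepuv : ∀ x ∈ Cu, ∀ y ∈ Cv, x ≠ y ∧ (G.Adj x y → x = u ∧ y = v)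
  hu : u ∈ Cu
  hv : v ∈ Cv

variable [Fintype V] {G : SimpleGraph V} {k : ℕ} {A T S Cu Cv : Finset V} {u v : V}
  {C : Finset (Finset V)}

theorem Setup.nbS (h : Setup G S u v Cu Cv C) : ∀ D ∈ C, Nb G D ⊆ S := by
  intro D hD y hy
  obtain ⟨hyD, x, hx, hxy⟩ := mem_Nb.1 hy
  by_contra hyS
  rcases h.cov y hyS with h1 | h1 | ⟨E, hE, h1⟩
  · exact (h.sepu D hD x hx y h1).2 hxy
  · exact (h.sepv D hD x hx y h1).2 hxy
  · by_cases hDE : D = E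
    · exact hyD (hDE ▸ h1)
    · exact (h.sep D hD E hE hDE x hx y h1).2 hxy

theorem Setup.cut (h : Setup G S u v Cu Cv C) {D : Finset V} (hD : D ∈ C) :
    IsCut G D (Nb G D) := by
  refine ⟨h.ne D hD, ?_, ?_, u, fun hu => (h.sepu D hD u hu u h.hu).1 rfl,
    fun hu => h.disu u h.hu (h.nbS D hD hu)⟩
  · rw [Finset.disjoint_left]; intro x hx hx'
    exact (mem_Nb.1 hx').1 hx
  · intro x hx y hxy
    by_cases hy : y ∈ D
    · exact Or.inl hy
    · exact Or.inr (mem_Nb.2 ⟨hy, x, hx, hxy⟩)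

theorem Setup.le_two (h : Setup G S u v Cu Cv C) (hcf : ClawFree G) (y : V) :
    (C.filter (fun D => y ∈ Nb G D)).card ≤ 2 := by
  by_contra hlt
  obtain ⟨D, E, F, hD, hE, hF, hDE, hDF, hEF⟩ := Finset.two_lt_card_iff.1 (not_le.1 hlt)
  simp only [mem_filter, mem_Nb] at hD hE hF
  obtain ⟨hD, -, d, hd, hdy⟩ := hD
  obtain ⟨hE, -, e, he, hey⟩ := hE
  obtain ⟨hF, -, f, hf, hfy⟩ := hF
  exact claw3 hcf (h.sep D hD E hE hDE d hd e he) (h.sep D hD F hF hDF d hd f hf)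
    (h.sep E hE F hF hEF e he f hf) hdy.symm hey.symm hfy.symm

theorem Setup.le_one (h : Setup G S u v Cu Cv C) (hcf : ClawFree G) (y : V)
    (hy : ∃ c, (c ∈ Cu ∨ c ∈ Cv) ∧ G.Adj c y) :
    (C.filter (fun D => y ∈ Nb G D)).card ≤ 1 := by
  by_contra hlt
  obtain ⟨D, hD, E, hE, hDE⟩ := Finset.one_lt_card.1 (not_le.1 hlt)
  simp only [mem_filter, mem_Nb] at hD hE
  obtain ⟨hD, -, d, hd, hdy⟩ := hD
  obtain ⟨hE, -, e, he, hey⟩ := hE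
  obtain ⟨c, hc, hcy⟩ := hy
  rcases hc with hc | hc
  · exact claw3 hcf (h.sep D hD E hE hDE d hd e he) (h.sepu D hD d hd c hc)
      (h.sepu E hE e he c hc) hdy.symm hey.symm hcy.symm
  · exact claw3 hcf (h.sep D hD E hE hDE d hd e he) (h.sepv D hD d hd c hc)
      (h.sepv E hE e he c hc) hdy.symm hey.symm hcy.symm

theorem Setup.only (h : Setup G S u v Cu Cv C) (hcf : ClawFree G) {y c c' : V}
    (hc : c ∈ Cu) (hc' : c' ∈ Cv) (hcy : G.Adj c y) (hcy' : G.Adj c' y)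
    (hD : ∃ D ∈ C, y ∈ Nb G D) : c = u ∧ c' = v := by
  obtain ⟨D, hD, hy⟩ := hD
  obtain ⟨-, d, hd, hdy⟩ := mem_Nb.1 hy
  by_contra hne
  have h1 := h.sepuv c hc c' hc'
  exact claw3 hcf (h.sepu D hD d hd c hc) (h.sepv D hD d hd c' hc')
    ⟨h1.1, fun ha => hne (h1.2 ha)⟩ hdy.symm hcy.symm hcy'.symm

theorem filter_zero_or (y : V) : (C.filter (fun D => y ∈ Nb G D)).card = 0 ∨
    ∃ D ∈ C, y ∈ Nb G D := by
  rcases Nat.eq_zero_or_pos (C.filter (fun D => y ∈ Nb G D)).card with h | h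
  · exact Or.inl h
  · obtain ⟨D, hD⟩ := Finset.card_pos.1 h
    exact Or.inr ⟨D, (mem_filter.1 hD).1, (mem_filter.1 hD).2⟩

/-- Vertices of `S` having a neighbour in a class. -/
noncomputable def At (G : SimpleGraph V) (S F : Finset V) : Finset V :=
  S.filter (fun y => ∃ c ∈ F, G.Adj c y)

/-- Vertices of `S` adjacent to both ends and to another class. -/
noncomputable def XX (G : SimpleGraph V) (S : Finset V) (u v : V) (C : Finset (Finset V)) :
    Finset V :=
  S.filter (fun y => G.Adj u y ∧ G.Adj v y ∧ ∃ D ∈ C, y ∈ Nb G D)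

theorem Setup.J (h : Setup G S u v Cu Cv C) (hcf : ClawFree G) :
    ∑ D ∈ C, (Nb G D).card + (At G S Cu).card + (At G S Cv).card ≤
      2 * S.card + (XX G S u v C).card := by
  rw [dcount S C h.nbS, At, At, XX, card_filter, card_filter, card_filter,
    ← sum_add_distrib, ← sum_add_distrib, mul_comm, ← smul_eq_mul, ← sum_const,
    ← sum_add_distrib]
  refine sum_le_sum fun y _ => ?_
  have h2 := h.le_two hcf y
  have h1 := h.le_one hcf y
  rcases filter_zero_or (G := G) (C := C) y with h0 | h0
  · rw [h0]; split_ifs <;> omega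
  · by_cases hu : ∃ c ∈ Cu, G.Adj c y
    · obtain ⟨c, hc, hcy⟩ := hu
      have h1 := h1 ⟨c, Or.inl hc, hcy⟩
      by_cases hv : ∃ c ∈ Cv, G.Adj c y
      · obtain ⟨c', hc', hcy'⟩ := hv
        obtain ⟨rfl, rfl⟩ := h.only hcf hc hc' hcy hcy' h0
        rw [if_pos (show G.Adj c y ∧ G.Adj c' y ∧ ∃ D ∈ C, y ∈ Nb G D from ⟨hcy, hcy', h0⟩)]
        split_ifs <;> omega
      · rw [if_neg hv]
        split_ifs <;> omega
    · rw [if_neg hu]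
      by_cases hv : ∃ c ∈ Cv, G.Adj c y
      · obtain ⟨c, hc, hcy⟩ := hv
        have h1 := h1 ⟨c, Or.inr hc, hcy⟩
        split_ifs <;> omega
      · rw [if_neg hv]
        split_ifs <;> omega

theorem Setup.I (h : Setup G S u v Cu Cv C) (hcf : ClawFree G) :
    ∑ D ∈ C, (Nb G D).card + 2 * (S.filter (fun y => G.Adj u y)).card
      + (S.filter (fun y => G.Adj v y)).card ≤
      2 * S.card + (S.filter (fun y => G.Adj u y ∧ G.Adj v y)).card
        + (S.filter (fun y => G.Adj u y ∧ ∃ D ∈ C, y ∈ Nb G D)).card := by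
  rw [dcount S C h.nbS, card_filter, card_filter, card_filter, card_filter, mul_sum,
    ← sum_add_distrib, ← sum_add_distrib, mul_comm, ← smul_eq_mul, ← sum_const,
    ← sum_add_distrib, ← sum_add_distrib]
  refine sum_le_sum fun y _ => ?_
  have h2 := h.le_two hcf y
  have h1 := h.le_one hcf y
  rcases filter_zero_or (G := G) (C := C) y with h0 | h0
  · rw [h0]; split_ifs <;> first | omega | tauto
  · have h1u : G.Adj u y → _ := fun hy => h1 ⟨u, Or.inl h.hu, hy⟩
    have h1v : G.Adj v y → _ := fun hy => h1 ⟨v, Or.inr h.hv, hy⟩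
    by_cases hu : G.Adj u y <;> by_cases hv : G.Adj v y <;> simp only [hu, hv, h0] <;>
      simp only [hu, hv, forall_true_left] at h1u h1v <;> simp <;> omega

theorem Setup.Cu_eq (h : Setup G S u v Cu Cv C) (hcf : ClawFree G) (hA : Atom G k A T)
    (hkA : k < 2 * A.card) (huA : u ∈ A) (hS : 2 * S.card + 1 ≤ k * C.card + 2 * k) :
    ∀ c ∈ Cu, c = u := by
  by_contra hne
  push Not at hne
  obtain ⟨c, hc, hcu⟩ := hne
  have huS := h.disu u h.hu
  have hvS := h.disv v h.hv
  have hJ := h.J hcf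
  have hsum := sum_ge C (fun D => (Nb G D).card) k (fun D hD => hA.conn _ _ (h.cut hD))
  have hXA : XX G S u v C ⊆ At G S Cu := by
    intro y hy
    simp only [XX, At, mem_filter] at hy ⊢
    exact ⟨hy.1, u, h.hu, hy.2.1⟩
  have hc1 : IsCut G (Cu.erase u) (insert u (At G S Cu \ XX G S u v C)) := by
    refine ⟨⟨c, mem_erase.2 ⟨hcu, hc⟩⟩, ?_, ?_, v, ?_, ?_⟩
    · rw [Finset.disjoint_left]
      intro x hx hx'
      rcases mem_insert.1 hx' with rfl | hx'
      · simp at hx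
      · exact h.disu x (mem_of_mem_erase hx) (mem_filter.1 (mem_sdiff.1 hx').1).1
    · intro x hx y hxy
      obtain ⟨hxu, hx⟩ := mem_erase.1 hx
      by_cases hyS : y ∈ S
      · right
        refine mem_insert_of_mem (mem_sdiff.2 ⟨mem_filter.2 ⟨hyS, x, hx, hxy⟩, fun hX => ?_⟩)
        obtain ⟨-, -, hvy, hD⟩ := mem_filter.1 hX
        exact hxu (h.only hcf hx h.hv hxy hvy hD).1
      · rcases h.cov y hyS with h1 | h1 | ⟨E, hE, h1⟩
        · by_cases hyu : y = u
          · right; rw [hyu]; exact mem_insert_self _ _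
          · left; exact mem_erase.2 ⟨hyu, h1⟩
        · exact absurd ((h.sepuv x hx y h1).2 hxy).1 hxu
        · exact absurd hxy.symm (h.sepu E hE y h1 x hx).2
    · intro hv
      exact (h.sepuv v (mem_of_mem_erase hv) v h.hv).1 rfl
    · intro hv
      rcases mem_insert.1 hv with hv | hv
      · exact (h.sepuv u h.hu v h.hv).1 hv.symm
      · exact hvS (mem_filter.1 (mem_sdiff.1 hv).1).1
  have hc2 : IsCut G Cv (insert u (At G S Cv)) := by
    refine ⟨⟨v, h.hv⟩, ?_, ?_, c, ?_, ?_⟩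
    · rw [Finset.disjoint_left]
      intro x hx hx'
      rcases mem_insert.1 hx' with rfl | hx'
      · exact (h.sepuv x h.hu x hx).1 rfl
      · exact h.disv x hx (mem_filter.1 hx').1
    · intro x hx y hxy
      by_cases hyS : y ∈ S
      · right
        exact mem_insert_of_mem (mem_filter.2 ⟨hyS, x, hx, hxy⟩)
      · rcases h.cov y hyS with h1 | h1 | ⟨E, hE, h1⟩
        · right
          rw [((h.sepuv y h1 x hx).2 hxy.symm).1]
          exact mem_insert_self _ _
        · exact Or.inl h1
        · exact absurd hxy.symm (h.sepv E hE y h1 x hx).2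
    · intro hv
      exact (h.sepuv c hc c hv).1 rfl
    · intro hv
      rcases mem_insert.1 hv with hv | hv
      · exact hcu hv
      · exact h.disu c hc (mem_filter.1 hv).1
  have e1 := hA.no_cut hkA hc1 huA (mem_insert_self _ _)
  have e2 := hA.no_cut hkA hc2 huA (mem_insert_self _ _)
  have f1 := card_insert_le u (At G S Cu \ XX G S u v C)
  have f2 := card_insert_le u (At G S Cv)
  have f3 := card_sdiff_add_card_eq_card hXA
  omega

theorem Setup.Cv_eq (h : Setup G S u v Cu Cv C) (hcf : ClawFree G) (hA : Atom G k A T)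
    (hCu : ∀ c ∈ Cu, c = u) (hdu : k + 2 ≤ (nb G u).card)
    (hS : 2 * S.card + 1 ≤ k * C.card + 2 * k) :
    ∀ c ∈ Cv, c = v := by
  by_contra hne
  push Not at hne
  obtain ⟨c, hc, hcu⟩ := hne
  have huS := h.disu u h.hu
  have hvS := h.disv v h.hv
  have hJ := h.J hcf
  have hsum := sum_ge C (fun D => (Nb G D).card) k (fun D hD => hA.conn _ _ (h.cut hD))
  have hXA : XX G S u v C ⊆ At G S Cv := by
    intro y hy
    simp only [XX, At, mem_filter] at hy ⊢
    exact ⟨hy.1, v, h.hv, hy.2.2.1⟩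
  have hc1 : IsCut G (Cv.erase v) (insert v (At G S Cv \ XX G S u v C)) := by
    refine ⟨⟨c, mem_erase.2 ⟨hcu, hc⟩⟩, ?_, ?_, u, ?_, ?_⟩
    · rw [Finset.disjoint_left]
      intro x hx hx'
      rcases mem_insert.1 hx' with rfl | hx'
      · simp at hx
      · exact h.disv x (mem_of_mem_erase hx) (mem_filter.1 (mem_sdiff.1 hx').1).1
    · intro x hx y hxy
      obtain ⟨hxu, hx⟩ := mem_erase.1 hx
      by_cases hyS : y ∈ S
      · right
        refine mem_insert_of_mem (mem_sdiff.2 ⟨mem_filter.2 ⟨hyS, x, hx, hxy⟩, fun hX => ?_⟩)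
        obtain ⟨-, huy, -, hD⟩ := mem_filter.1 hX
        exact hxu (h.only hcf h.hu hx huy hxy hD).2
      · rcases h.cov y hyS with h1 | h1 | ⟨E, hE, h1⟩
        · exact absurd ((h.sepuv y h1 x hx).2 hxy.symm).2 hxu
        · by_cases hyu : y = v
          · right; rw [hyu]; exact mem_insert_self _ _
          · left; exact mem_erase.2 ⟨hyu, h1⟩
        · exact absurd hxy.symm (h.sepv E hE y h1 x hx).2
    · intro hv
      exact (h.sepuv u h.hu u (mem_of_mem_erase hv)).1 rfl
    · intro hv
      rcases mem_insert.1 hv with hv | hv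
      · exact (h.sepuv u h.hu v h.hv).1 hv
      · exact huS (mem_filter.1 (mem_sdiff.1 hv).1).1
  have e1 := hA.conn _ _ hc1
  have f1 := card_insert_le v (At G S Cv \ XX G S u v C)
  have f3 := card_sdiff_add_card_eq_card hXA
  have f4 : nb G u ⊆ insert v (At G S Cu) := by
    intro y hy
    have hy := mem_nb.1 hy
    by_cases hyS : y ∈ S
    · exact mem_insert_of_mem (mem_filter.2 ⟨hyS, u, h.hu, hy⟩)
    · rcases h.cov y hyS with h1 | h1 | ⟨E, hE, h1⟩
      · exact absurd (hCu y h1).symm hy.ne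
      · rw [((h.sepuv u h.hu y h1).2 hy).2]; exact mem_insert_self _ _
      · exact absurd hy.symm (h.sepu E hE y h1 u h.hu).2
  have f5 := card_le_card f4
  have f6 := card_insert_le v (At G S Cu)
  omega

theorem Setup.edgeData (h : Setup G S u v Cu Cv C) (hcf : ClawFree G)
    (hCu : ∀ c ∈ Cu, c = u) (hCv : ∀ c ∈ Cv, c = v)
    (hS : 2 * S.card + 1 ≤ k * C.card + 2 * k) : EdgeData G k u v C where
  ne := h.ne
  sep := h.sep
  u_notMem := fun D hD hu => (h.sepu D hD u hu u h.hu).1 rfl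
  v_notMem := fun D hD hv => (h.sepv D hD v hv v h.hv).1 rfl
  u_Nb := fun D hD hu => h.disu u h.hu (h.nbS D hD hu)
  v_Nb := fun D hD hv => h.disv v h.hv (h.nbS D hD hv)
  ineq := by
    have hI := h.I hcf
    have f4 : nb G u ⊆ insert v (S.filter (fun y => G.Adj u y)) := by
      intro y hy
      have hy := mem_nb.1 hy
      by_cases hyS : y ∈ S
      · exact mem_insert_of_mem (mem_filter.2 ⟨hyS, hy⟩)
      · rcases h.cov y hyS with h1 | h1 | ⟨E, hE, h1⟩
        · exact absurd (hCu y h1).symm hy.ne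
        · rw [hCv y h1]; exact mem_insert_self _ _
        · exact absurd hy.symm (h.sepu E hE y h1 u h.hu).2
    have f5 : nb G v ⊆ insert u (S.filter (fun y => G.Adj v y)) := by
      intro y hy
      have hy := mem_nb.1 hy
      by_cases hyS : y ∈ S
      · exact mem_insert_of_mem (mem_filter.2 ⟨hyS, hy⟩)
      · rcases h.cov y hyS with h1 | h1 | ⟨E, hE, h1⟩
        · rw [hCu y h1]; exact mem_insert_self _ _
        · exact absurd (hCv y h1).symm hy.ne
        · exact absurd hy.symm (h.sepv E hE y h1 v h.hv).2
    have f6 : S.filter (fun y => G.Adj u y ∧ G.Adj v y) ⊆ nb G u ∩ nb G v := by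
      intro y hy
      have := (mem_filter.1 hy).2
      exact mem_inter.2 ⟨mem_nb.2 this.1, mem_nb.2 this.2⟩
    have f7 : S.filter (fun y => G.Adj u y ∧ ∃ D ∈ C, y ∈ Nb G D) ⊆
        nb G u ∩ C.biUnion (Nb G) := by
      intro y hy
      have := (mem_filter.1 hy).2
      exact mem_inter.2 ⟨mem_nb.2 this.1, mem_biUnion.2 this.2⟩
    have g4 := (card_le_card f4).trans (card_insert_le _ _)
    have g5 := (card_le_card f5).trans (card_insert_le _ _)
    have g6 := card_le_card f6
    have g7 := card_le_card f7
    omega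

theorem setup_exists {t : ℚ} (hk : (k : ℚ) = 2 * t) (huv : G.Adj u v)
    (htough : ∀ S : Finset V, 2 ≤ numComponents G ↑S →
      t ≤ (S.card : ℚ) / (numComponents G ↑S : ℚ))
    (h2 : 2 ≤ numComponents (G.deleteEdges {s(u, v)}) ↑S)
    (hlt : (S.card : ℚ) / (numComponents (G.deleteEdges {s(u, v)}) ↑S : ℚ) < t) :
    ∃ Cu Cv C, Setup G S u v Cu Cv C ∧ 2 * S.card + 1 ≤ k * C.card + 2 * k := by
  obtain ⟨C, hCc, hC⟩ := parts_exist (G.deleteEdges {s(u, v)}) S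
  rw [← hCc] at h2 hlt
  have hcpos : (0 : ℚ) < C.card := by exact_mod_cast (by omega : 0 < C.card)
  have hadj : ∀ x y, G.Adj x y →
      (G.deleteEdges {s(u, v)}).Adj x y ∨ (x = u ∧ y = v) ∨ (x = v ∧ y = u) := by
    intro x y hxy
    by_cases hs : s(x, y) = s(u, v)
    · right; simpa using hs
    · left; rw [deleteEdges_adj]; exact ⟨hxy, by simpa using hs⟩
  have hnot : ¬ Parts G S C := by
    intro hP
    have h3 := parts_card_le G S C hP
    have h4 := htough S (h2.trans h3)
    have h3' : (C.card : ℚ) ≤ numComponents G ↑S := by exact_mod_cast h3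
    have h5 : (S.card : ℚ) / (numComponents G ↑S : ℚ) ≤ (S.card : ℚ) / C.card :=
      div_le_div_of_nonneg_left (by positivity) hcpos h3'
    linarith
  have hkey : ∃ Cu ∈ C, ∃ Cv ∈ C, u ∈ Cu ∧ v ∈ Cv ∧ Cu ≠ Cv := by
    by_contra hno
    push Not at hno
    apply hnot
    refine ⟨hC.ne, hC.dis, hC.cov, hC.uniq, ?_⟩
    intro D hD x hx y hxy hyS
    rcases hadj x y hxy with h | ⟨rfl, rfl⟩ | ⟨rfl, rfl⟩
    · exact hC.closed D hD x hx y h hyS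
    · obtain ⟨E, hE, hyE⟩ := hC.cov y hyS
      rw [hno D hD E hE hx hyE]; exact hyE
    · obtain ⟨E, hE, hyE⟩ := hC.cov y hyS
      rw [← hno E hE D hD hyE hx]; exact hyE
  obtain ⟨Cu, hCu, Cv, hCv, hu, hv, hne⟩ := hkey
  have hsep0 : ∀ D ∈ C, ∀ E ∈ C, D ≠ E → ∀ x ∈ D, ∀ y ∈ E, x ≠ y ∧
      ¬ (G.deleteEdges {s(u, v)}).Adj x y := by
    intro D hD E hE hDE x hx y hy
    refine ⟨?_, ?_⟩
    · rintro rfl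
      exact hDE (hC.uniq D hD E hE x hx hy)
    · intro hxy
      exact hDE (hC.uniq D hD E hE y (hC.closed D hD x hx y hxy (hC.dis E hE y hy)) hy)
  have hsep1 : ∀ D ∈ C, D ≠ Cu → D ≠ Cv → ∀ E ∈ C, D ≠ E → ∀ x ∈ D, ∀ y ∈ E, x ≠ y ∧
      ¬ G.Adj x y := by
    intro D hD hDu hDv E hE hDE x hx y hy
    have h0 := hsep0 D hD E hE hDE x hx y hy
    refine ⟨h0.1, fun hxy => ?_⟩
    rcases hadj x y hxy with h | ⟨rfl, rfl⟩ | ⟨rfl, rfl⟩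
    · exact h0.2 h
    · exact hDu (hC.uniq D hD Cu hCu x hx hu)
    · exact hDv (hC.uniq D hD Cv hCv x hx hv)
  refine ⟨Cu, Cv, (C.erase Cu).erase Cv, ⟨?_, ?_, hC.dis Cu hCu, hC.dis Cv hCv, ?_, ?_, ?_, ?_,
    ?_, hu, hv⟩, ?_⟩
  · intro D hD
    exact hC.ne D (mem_of_mem_erase (mem_of_mem_erase hD))
  · intro D hD
    exact hC.dis D (mem_of_mem_erase (mem_of_mem_erase hD))
  · intro x hx
    obtain ⟨D, hD, hxD⟩ := hC.cov x hx
    by_cases h1 : D = Cu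
    · left; rwa [← h1]
    · by_cases h2 : D = Cv
      · right; left; rwa [← h2]
      · right; right; exact ⟨D, mem_erase.2 ⟨h2, mem_erase.2 ⟨h1, hD⟩⟩, hxD⟩
  · intro D hD E hE hDE
    simp only [mem_erase] at hD hE
    exact hsep1 D hD.2.2 hD.2.1 hD.1 E hE.2.2 hDE
  · intro D hD
    simp only [mem_erase] at hD
    exact hsep1 D hD.2.2 hD.2.1 hD.1 Cu hCu hD.2.1
  · intro D hD
    simp only [mem_erase] at hD
    exact hsep1 D hD.2.2 hD.2.1 hD.1 Cv hCv hD.1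
  · intro x hx y hy
    have h0 := hsep0 Cu hCu Cv hCv hne x hx y hy
    refine ⟨h0.1, fun hxy => ?_⟩
    rcases hadj x y hxy with h | h | ⟨rfl, rfl⟩
    · exact absurd h h0.2
    · exact h
    · exact absurd (hC.uniq Cu hCu Cv hCv x hx hv) hne
  · have c1 := card_erase_add_one hCu
    have c2 := card_erase_add_one (mem_erase.2 ⟨hne.symm, hCv⟩ : Cv ∈ C.erase Cu)
    rw [div_lt_iff₀ hcpos] at hlt
    have h6 : ((2 * S.card : ℕ) : ℚ) < ((k * C.card : ℕ) : ℚ) := by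
      push_cast
      rw [hk]; linarith
    have h7 : 2 * S.card < k * C.card := by exact_mod_cast h6
    have h8 : C.card = ((C.erase Cu).erase Cv).card + 2 := by omega
    rw [h8] at h7
    have : k * (((C.erase Cu).erase Cv).card + 2) = k * ((C.erase Cu).erase Cv).card + 2 * k := by
      ring
    omega

end Edge

section Final

variable [Fintype V] {G : SimpleGraph V}

theorem exists_k {t : ℚ} (hcf : ClawFree G) (ht : HasToughness G t) :
    ∃ k : ℕ, (k : ℚ) = 2 * t ∧ (∃ F W, IsCut G F W ∧ W.card = k) ∧
      ∀ F W, IsCut G F W → k ≤ W.card := by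
  obtain ⟨hlow, S, h2, hS⟩ := ht
  obtain ⟨C, hCc, hC⟩ := parts_exist G S
  rw [← hCc] at h2 hS
  have hcpos : (0 : ℚ) < C.card := by exact_mod_cast (by omega : 0 < C.card)
  have hsep : ∀ D ∈ C, ∀ E ∈ C, D ≠ E → ∀ x ∈ D, ∀ y ∈ E, x ≠ y ∧ ¬ G.Adj x y := by
    intro D hD E hE hDE x hx y hy
    refine ⟨?_, ?_⟩
    · rintro rfl
      exact hDE (hC.uniq D hD E hE x hx hy)
    · intro hxy
      exact hDE (hC.uniq D hD E hE y (hC.closed D hD x hx y hxy (hC.dis E hE y hy)) hy)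
  have hnbS : ∀ D ∈ C, Nb G D ⊆ S := by
    intro D hD y hy
    obtain ⟨hyD, x, hx, hxy⟩ := mem_Nb.1 hy
    by_contra hyS
    exact hyD (hC.closed D hD x hx y hxy hyS)
  have hcut : ∀ D ∈ C, IsCut G D (Nb G D) := by
    intro D hD
    obtain ⟨E, hE, hED⟩ := exists_mem_ne (by omega : 1 < C.card) D
    obtain ⟨e, he⟩ := hC.ne E hE
    refine ⟨hC.ne D hD, ?_, ?_, e, fun h => hED (hC.uniq E hE D hD e he h),
      fun h => hC.dis E hE e he (hnbS D hD h)⟩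
    · rw [Finset.disjoint_left]; intro x hx hx'
      exact (mem_Nb.1 hx').1 hx
    · intro x hx y hxy
      by_cases hy : y ∈ D
      · exact Or.inl hy
      · exact Or.inr (mem_Nb.2 ⟨hy, x, hx, hxy⟩)
  have hle : ∀ y, (C.filter (fun D => y ∈ Nb G D)).card ≤ 2 := by
    intro y
    by_contra hlt
    obtain ⟨D, E, F, hD, hE, hF, hDE, hDF, hEF⟩ := Finset.two_lt_card_iff.1 (not_le.1 hlt)
    simp only [mem_filter, mem_Nb] at hD hE hF
    obtain ⟨hD, -, d, hd, hdy⟩ := hD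
    obtain ⟨hE, -, e, he, hey⟩ := hE
    obtain ⟨hF, -, f, hf, hfy⟩ := hF
    exact claw3 hcf (hsep D hD E hE hDE d hd e he) (hsep D hD F hF hDF d hd f hf)
      (hsep E hE F hF hEF e he f hf) hdy.symm hey.symm hfy.symm
  have hsum : ∑ D ∈ C, (Nb G D).card ≤ S.card * 2 := by
    rw [dcount S C hnbS, ← smul_eq_mul, ← sum_const]
    exact sum_le_sum fun y _ => hle y
  have hex : ∃ k, ∃ F W, IsCut G F W ∧ W.card = k := by
    obtain ⟨D, hD⟩ := card_pos.1 (by omega : 0 < C.card)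
    exact ⟨_, D, _, hcut D hD, rfl⟩
  have hmin : ∀ F W, IsCut G F W → Nat.find hex ≤ W.card :=
    fun F W h => Nat.find_min' hex ⟨F, W, h, rfl⟩
  refine ⟨Nat.find hex, ?_, Nat.find_spec hex, hmin⟩
  obtain ⟨F, W, hFW, hW⟩ := Nat.find_spec hex
  apply le_antisymm
  · have h3 := sum_ge C (fun D => (Nb G D).card) (Nat.find hex) (fun D hD => hmin _ _ (hcut D hD))
    have h4 : Nat.find hex * C.card ≤ S.card * 2 := h3.trans hsum
    have h5 : ((Nat.find hex : ℕ) : ℚ) * C.card ≤ S.card * 2 := by exact_mod_cast h4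
    rw [hS, ← mul_div_assoc, le_div_iff₀ hcpos]
    linarith
  · have h3 := hFW.two_le
    have h4 := hlow W h3
    have h3' : (2 : ℚ) ≤ numComponents G ↑W := by exact_mod_cast h3
    have h5 : (W.card : ℚ) / (numComponents G ↑W : ℚ) ≤ (W.card : ℚ) / 2 :=
      div_le_div_of_nonneg_left (by positivity) (by norm_num) h3'
    rw [← hW]
    linarith

theorem exists_atom {k : ℕ} (hex : ∃ F W, IsCut G F W ∧ W.card = k)
    (hmin : ∀ F W, IsCut G F W → k ≤ W.card) : ∃ A T, Atom G k A T := by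
  have hex2 : ∃ n, ∃ F W, IsCut G F W ∧ W.card = k ∧ F.card = n := by
    obtain ⟨F, W, h, hW⟩ := hex
    exact ⟨_, F, W, h, hW, rfl⟩
  obtain ⟨A, T, hAT, hT, hA⟩ := Nat.find_spec hex2
  refine ⟨A, T, hmin, hAT, hT, ?_⟩
  intro F W hFW hW
  rw [hA]
  exact Nat.find_min' hex2 ⟨F, W, hFW, le_antisymm hW (hmin _ _ hFW), rfl⟩

theorem final_false {t : ℚ} (ht : 2 ≤ t) (hmt : MinimallyTough G t) (hcf : ClawFree G)
    (hdeg : ∀ k : ℕ, (k : ℚ) = 2 * t → ∀ v, 5 * k ≤ 3 * (nb G v).card + 2) : False := by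
  obtain ⟨hT, hmin⟩ := hmt
  obtain ⟨k, hk, hex, hconn⟩ := exists_k hcf hT
  obtain ⟨A, T, hA⟩ := exists_atom hex hconn
  have hdeg := hdeg k hk
  have hk4 : 4 ≤ k := by
    have : (4 : ℚ) ≤ k := by rw [hk]; linarith
    exact_mod_cast this
  have hkA : k < 2 * A.card := by
    obtain ⟨a, ha⟩ := hA.cut.1
    have hsub : nb G a ⊆ A.erase a ∪ T := by
      intro y hy
      have hy := mem_nb.1 hy
      rcases hA.cut.2.2.1 a ha y hy with h | h
      · exact mem_union_left _ (mem_erase.2 ⟨hy.ne.symm, h⟩)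
      · exact mem_union_right _ h
    have h1 := (card_le_card hsub).trans (card_union_le _ _)
    have h2 := card_erase_add_one ha
    have h3 := hA.card
    have h4 := hdeg a
    omega
  refine main_false hk4 hdeg hcf hA ?_
  intro u hu v huv
  obtain ⟨S, h2, hlt⟩ := hmin u v huv
  obtain ⟨Cu, Cv, C, hs, hS⟩ := setup_exists hk huv hT.1 h2 hlt
  have hCu := hs.Cu_eq hcf hA hkA hu hS
  have hd := hdeg u
  have hCv := hs.Cv_eq hcf hA hCu (by omega) hS
  exact ⟨C, hs.edgeData hcf hCu hCv hS⟩

end Final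

end Helpers

/-- For `t ≥ 2`, every minimally `t`-tough, claw-free graph has a vertex of
degree at most `⌈(10t − 5)/3⌉`. -/
theorem minimally_t_tough_claw_free_min_degree_bound [Fintype V]
    (G : SimpleGraph V) [DecidableRel G.Adj] (t : ℚ) (ht : 2 ≤ t)
    (hmt : MinimallyTough G t) (hcf : ClawFree G) :
    ∃ v : V, (G.degree v : ℤ) ≤ ⌈(10 * t - 5) / 3⌉ := by
  by_contra hno
  push Not at hno
  refine final_false ht hmt hcf ?_
  intro k hk v
  have h1 := hno v
  have h2 : (nb G v).card = G.degree v := by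
    rw [← G.card_neighborFinset_eq_degree]
    congr 1
    ext y
    rw [mem_nb, SimpleGraph.mem_neighborFinset]
  rw [h2]
  have h3 : (10 * t - 5) / 3 ≤ (⌈(10 * t - 5) / 3⌉ : ℚ) := Int.le_ceil _
  have h4 : ((⌈(10 * t - 5) / 3⌉ + 1 : ℤ) : ℚ) ≤ ((G.degree v : ℤ) : ℚ) := by
    exact_mod_cast h1
  push_cast at h4
  have h5 : (5 : ℚ) * k ≤ 3 * (G.degree v : ℚ) + 2 := by linarith
  exact_mod_cast h5
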